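/- arXiv:2106.03045 — 2 statements merged into one kernel-verified Lean document; each statement's English description precedes it below -/
import Mathlib

section
/- Let α, β, γ, δ ∈ ℝ with α + δ ≠ 0 and αγ − βδ = 0. For the Lie algebra 𝔤₆ with its Bott connection ∇^B, the symmetrized Ricci tensor ρ̃^B of ∇^B is a Codazzi tensor for ∇^B if and only if either (1) α = β = 0 (and hence δ ≠ 0), or (2) α ≠ 0, γ = 0 and βδ = 0. -/
noncomputable section

/-- The underlying vector space `V = ℝ³`. -/
abbrev V : Type := Fin 3 → ℝ

/-- The basis vector e₁. -/
def e1 : V := ![1, 0, 0]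
/-- The basis vector e₂. -/
def e2 : V := ![0, 1, 0]
/-- The basis vector e₃. -/
def e3 : V := ![0, 0, 1]

/-- The Lorentzian inner product with g(e₁,e₁)=g(e₂,e₂)=1, g(e₃,e₃)=−1. -/
def gL (x y : V) : ℝ := x 0 * y 0 + x 1 * y 1 - x 2 * y 2

/-- Curvature R(X,Y)Z = ∇_X ∇_Y Z − ∇_Y ∇_X Z − ∇_{[X,Y]} Z. -/
def curv (nabla bracket : V → V → V) (x y z : V) : V :=
  nabla x (nabla y z) - nabla y (nabla x z) - nabla (bracket x y) z

/-- Ricci tensor ρ(X,Y) = −g(R(X,e₁)Y,e₁) − g(R(X,e₂)Y,e₂) + g(R(X,e₃)Y,e₃). -/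
def ricci (nabla bracket : V → V → V) (x y : V) : ℝ :=
  - gL (curv nabla bracket x e1 y) e1 - gL (curv nabla bracket x e2 y) e2
  + gL (curv nabla bracket x e3 y) e3

/-- Symmetrized Ricci tensor ρ̃(X,Y) = (ρ(X,Y) + ρ(Y,X))/2. -/
def ricciSym (nabla bracket : V → V → V) (x y : V) : ℝ :=
  (ricci nabla bracket x y + ricci nabla bracket y x) / 2

/-- Covariant derivative of a (left-invariant) bilinear form:
(∇_X ω)(Y,Z) = −ω(∇_X Y, Z) − ω(Y, ∇_X Z). -/
def covDer (nabla : V → V → V) (ω : V → V → ℝ) (x y z : V) : ℝ :=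
  - ω (nabla x y) z - ω y (nabla x z)

/-- ω is a Codazzi tensor for ∇: (∇_X ω)(Y,Z) = (∇_Y ω)(X,Z) for all X,Y,Z. -/
def IsCodazzi (nabla : V → V → V) (ω : V → V → ℝ) : Prop :=
  ∀ x y z : V, covDer nabla ω x y z = covDer nabla ω y x z

/-- Torsion T(X,Y) = ∇_X Y − ∇_Y X − [X,Y]. -/
def torsion (nabla bracket : V → V → V) (x y : V) : V :=
  nabla x y - nabla y x - bracket x y

/-- (V,∇,ω) is a quasi-statistical structure:
(∇_X ω)(Y,Z) − (∇_Y ω)(X,Z) + ω(T(X,Y),Z) = 0 for all X,Y,Z. -/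
def IsQuasiStatistical (nabla bracket : V → V → V) (ω : V → V → ℝ) : Prop :=
  ∀ x y z : V,
    covDer nabla ω x y z - covDer nabla ω y x z + ω (torsion nabla bracket x y) z = 0

/-- The Lie bracket of the Lie algebra 𝔤6. -/
def bracket (α β γ δ : ℝ) (x y : V) : V :=
  ![ (0:ℝ),
     (x 0 * y 1 - x 1 * y 0) * (α) + (x 0 * y 2 - x 2 * y 0) * (γ),
     (x 0 * y 1 - x 1 * y 0) * (β) + (x 0 * y 2 - x 2 * y 0) * (δ) ]

/-- The Bott connection ∇^B of 𝔤6. -/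
def nabla (α β γ δ : ℝ) (x y : V) : V :=
  ![ x 1 * y 1 * (α),
     x 1 * y 0 * (-α) + x 2 * y 0 * (-γ),
     x 0 * y 2 * (δ) ]

/-- The symmetrized Ricci tensor of the Bott connection is diagonal. -/
theorem ricciSym_nabla (α β γ δ : ℝ) (x y : V) :
    ricciSym (nabla α β γ δ) (bracket α β γ δ) x y =
      -(α ^ 2 + β * γ) * (x 0 * y 0) - α ^ 2 * (x 1 * y 1) := by
  simp [ricciSym, ricci, curv, gL, nabla, bracket, e1, e2, e3]
  ring

theorem stmt4 (α β γ δ : ℝ) (h1 : α + δ ≠ 0) (h2 : α * γ - β * δ = 0) :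
    IsCodazzi (nabla α β γ δ) (ricciSym (nabla α β γ δ) (bracket α β γ δ)) ↔ ((α = 0 ∧ β = 0) ∨ (α ≠ 0 ∧ γ = 0 ∧ β * δ = 0)) := by
  simp only [IsCodazzi, covDer, ricciSym_nabla]
  constructor
  · intro h
    have hαγ : α ^ 2 * γ = 0 := by simpa [nabla, e1, e2, e3] using h e1 e3 e2
    rcases eq_or_ne α 0 with rfl | hα
    · have hδ : δ ≠ 0 := by simpa using h1
      exact Or.inl ⟨rfl, by simpa [hδ] using h2⟩
    · have hγ : γ = 0 := by simpa [hα] using hαγ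
      subst hγ
      exact Or.inr ⟨hα, rfl, by linarith⟩
  · rintro (⟨rfl, rfl⟩ | ⟨-, rfl, -⟩) x y z
    · simp [nabla]
    · simp [nabla]
      ring

end
end

section
/- Let α, β, γ, δ ∈ ℝ with α + δ ≠ 0 and αγ − βδ = 0. For the Lie algebra 𝔤₆ with its Bott connection ∇^B and symmetrized Ricci tensor ρ̃^B, the triple (𝔤₆, ∇^B, ρ̃^B) is a quasi-statistical structure if and only if either (1) α = β = 0 (and hence δ ≠ 0), or (2) α ≠ 0, γ = 0 and βδ = 0. -/
noncomputable section

theorem ricciSym_nabla_bracket (α β γ δ : ℝ) (x y : V) :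
    ricciSym (nabla α β γ δ) (bracket α β γ δ) x y =
      -((α ^ 2 + β * γ) * (x 0 * y 0) + α ^ 2 * (x 1 * y 1)) := by
  simp [ricciSym, ricci, curv, gL, nabla, bracket, e1, e2, e3]
  ring

theorem stmt11 (α β γ δ : ℝ) (h1 : α + δ ≠ 0) (h2 : α * γ - β * δ = 0) :
    IsQuasiStatistical (nabla α β γ δ) (bracket α β γ δ) (ricciSym (nabla α β γ δ) (bracket α β γ δ)) ↔ ((α = 0 ∧ β = 0) ∨ (α ≠ 0 ∧ γ = 0 ∧ β * δ = 0)) := by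
  constructor
  · intro h
    by_cases hα : α = 0
    · have hδ : δ ≠ 0 := by simpa [hα] using h1
      have hβ : β = 0 := by simpa [hα, hδ] using h2
      exact Or.inl ⟨hα, hβ⟩
    · have hγ : γ = 0 := by
        simpa [covDer, torsion, ricciSym_nabla_bracket, nabla, bracket, e1, e2, e3, hα]
          using h e1 e3 e2
      exact Or.inr ⟨hα, hγ, by linear_combination α * hγ - h2⟩
  · rintro (⟨rfl, rfl⟩ | ⟨-, rfl, -⟩) x y z
    · simp [covDer, ricciSym_nabla_bracket]
    · simp [covDer, torsion, ricciSym_nabla_bracket, nabla, bracket]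
      ring

end
end
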